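/- Let α, β > −1 be reals, let n, r be integers with 1 ≤ r ≤ n, and let f : [0,1] → ℝ be (r+2) times continuously differentiable. Then ‖ (Γ(n+α+β+r+2)Γ(n−r+1)/(Γ(n+α+β+2)Γ(n+1))) · (M_n^{(α,β)} f)^{(r)} − M_{n−r}^{(α,β)}(f^{(r)}) ‖ ≤ (1/4)·‖f^{(r+2)}‖·(n+α+β+3)/((n+α+β+3)² − r²) + ω(f^{(r)}, r(n−r+|β−α|)/((n+2+α+β)² − r²)). -/

import Mathlib

/-- Bernstein basis polynomial `p_{n,k}(x) = C(n,k) x^k (1-x)^{n-k}`. -/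
noncomputable def bern (n k : ℕ) (x : ℝ) : ℝ :=
  (n.choose k : ℝ) * x ^ k * (1 - x) ^ (n - k)

/-- Durrmeyer operator with Jacobi weight `t^α (1-t)^β`:
`M_n^{(α,β)}(f;x) = Σ_{k=0}^n p_{n,k}(x) (1/c_{n,k}^{(α,β)}) ∫₀¹ p_{n,k}(t) t^α (1-t)^β f(t) dt`. -/
noncomputable def durrmeyerJ (α β : ℝ) (n : ℕ) (f : ℝ → ℝ) (x : ℝ) : ℝ :=
  ∑ k ∈ Finset.range (n + 1), bern n k x *
    ((∫ t in (0:ℝ)..1, bern n k t * t ^ α * (1 - t) ^ β * f t) /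
      (∫ t in (0:ℝ)..1, bern n k t * t ^ α * (1 - t) ^ β))

/-- Supremum norm on `[0,1]`. -/
noncomputable def supNorm (g : ℝ → ℝ) : ℝ :=
  ⨆ x : Set.Icc (0:ℝ) 1, |g x|

/-- First modulus of continuity on `[0,1]`. -/
noncomputable def modCont (g : ℝ → ℝ) (δ : ℝ) : ℝ :=
  sSup {d : ℝ | ∃ x ∈ Set.Icc (0:ℝ) 1, ∃ y ∈ Set.Icc (0:ℝ) 1, |x - y| ≤ δ ∧ d = |g x - g y|}

/-- The integral of `h` against the unnormalized Beta density `t ^ (a - 1) * (1 - t) ^ (b - 1)`. -/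
noncomputable def betaInt (a b : ℝ) (h : ℝ → ℝ) : ℝ :=
  ∫ t in (0:ℝ)..1, t ^ (a - 1) * (1 - t) ^ (b - 1) * h t

/-- The expectation of `h` under the Beta distribution with parameters `a`, `b`. -/
noncomputable def betaMean (a b : ℝ) (h : ℝ → ℝ) : ℝ :=
  betaInt a b h / betaInt a b fun _ => 1

section BetaInt

open Set MeasureTheory

variable {a b : ℝ}

lemma intervalIntegrable_beta (ha : 0 < a) (hb : 0 < b) {h : ℝ → ℝ} (hh : Continuous h) :
    IntervalIntegrable (fun t : ℝ => t ^ (a - 1) * (1 - t) ^ (b - 1) * h t) volume 0 1 := by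
  refine IntervalIntegrable.mul_continuousOn ?_ hh.continuousOn
  have key := (Complex.betaIntegral_convergent (u := a) (v := b) (by simpa) (by simpa)).norm
  refine key.congr_uIoo ?_
  intro t ht
  rw [uIoo_of_le zero_le_one] at ht
  have h1 : 0 < 1 - t := by linarith [ht.2]
  have e : (1 - (t : ℂ)) = ((1 - t : ℝ) : ℂ) := by push_cast; rfl
  simp only [norm_mul, e]
  rw [Complex.norm_cpow_eq_rpow_re_of_pos ht.1, Complex.norm_cpow_eq_rpow_re_of_pos h1]
  simp

lemma betaInt_one_pos (ha : 0 < a) (hb : 0 < b) : 0 < betaInt a b fun _ => 1 := by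
  refine intervalIntegral.intervalIntegral_pos_of_pos_on
    (intervalIntegrable_beta ha hb continuous_const) (fun t ht => ?_) zero_lt_one
  have h0 := Real.rpow_pos_of_pos ht.1 (a - 1)
  have h1 := Real.rpow_pos_of_pos (sub_pos.2 ht.2) (b - 1)
  positivity

lemma betaInt_add (ha : 0 < a) (hb : 0 < b) {g h : ℝ → ℝ} (hg : Continuous g)
    (hh : Continuous h) : betaInt a b (fun t => g t + h t) = betaInt a b g + betaInt a b h := by
  simp only [betaInt, mul_add]
  exact intervalIntegral.integral_add (intervalIntegrable_beta ha hb hg)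
    (intervalIntegrable_beta ha hb hh)

lemma betaInt_const_mul (c : ℝ) (h : ℝ → ℝ) :
    betaInt a b (fun t => c * h t) = c * betaInt a b h := by
  simp only [betaInt, ← intervalIntegral.integral_const_mul]
  congr 1; ext t; ring

lemma betaInt_mono (ha : 0 < a) (hb : 0 < b) {g h : ℝ → ℝ} (hg : Continuous g)
    (hh : Continuous h) (hgh : ∀ t ∈ Icc (0:ℝ) 1, g t ≤ h t) : betaInt a b g ≤ betaInt a b h := by
  refine intervalIntegral.integral_mono_on zero_le_one (intervalIntegrable_beta ha hb hg)
    (intervalIntegrable_beta ha hb hh) fun t ht => ?_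
  have h0 := Real.rpow_nonneg ht.1 (a - 1)
  have h1 := Real.rpow_nonneg (sub_nonneg.2 ht.2) (b - 1)
  exact mul_le_mul_of_nonneg_left (hgh t ht) (by positivity)

lemma betaInt_succ_left (h : ℝ → ℝ) :
    betaInt (a + 1) b h = betaInt a b fun t => t * h t := by
  refine intervalIntegral.integral_congr_Ioo_of_le zero_le_one fun t ht => ?_
  have : t ^ (a + 1 - 1) = t ^ (a - 1) * t := by
    rw [← Real.rpow_add_one ht.1.ne']; ring_nf
  simp only [this]; ring

lemma betaInt_succ_right (h : ℝ → ℝ) :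
    betaInt a (b + 1) h = betaInt a b fun t => (1 - t) * h t := by
  refine intervalIntegral.integral_congr_Ioo_of_le zero_le_one fun t ht => ?_
  have : (1 - t) ^ (b + 1 - 1) = (1 - t) ^ (b - 1) * (1 - t) := by
    rw [← Real.rpow_add_one (sub_pos.2 ht.2).ne']; ring_nf
  simp only [this]; ring

/-- Integration by parts against a Beta density. -/
lemma betaInt_deriv (ha : 0 < a) (hb : 0 < b) {h : ℝ → ℝ} (hh : ContDiff ℝ 1 h) :
    betaInt (a + 1) (b + 1) (deriv h) =
      b * betaInt (a + 1) b h - a * betaInt a (b + 1) h := by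
  have i1 := (intervalIntegrable_beta ha (by linarith : 0 < b + 1) hh.continuous).const_mul a
  have i2 := (intervalIntegrable_beta (by linarith : 0 < a + 1) hb hh.continuous).const_mul b
  have i3 := intervalIntegrable_beta (by linarith : 0 < a + 1) (by linarith : 0 < b + 1)
    hh.continuous_deriv_one
  have key := intervalIntegral.integral_eq_sub_of_hasDerivAt_of_le zero_le_one
    (f := fun t : ℝ => t ^ a * (1 - t) ^ b * h t) ?_ ?_ ((i1.sub i2).add i3)
  · rw [intervalIntegral.integral_add (i1.sub i2) i3, intervalIntegral.integral_sub i1 i2,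
      intervalIntegral.integral_const_mul, intervalIntegral.integral_const_mul] at key
    simp only [sub_self, Real.zero_rpow ha.ne', Real.zero_rpow hb.ne', zero_mul, mul_zero] at key
    unfold betaInt
    linarith
  · refine ((continuousOn_id.rpow_const fun x _ => Or.inr ha.le).mul
      ((continuousOn_const.sub continuousOn_id).rpow_const fun x _ => Or.inr hb.le)).mul
      hh.continuous.continuousOn
  · intro t ht
    have h1 : HasDerivAt (fun t : ℝ => t ^ a) (a * t ^ (a - 1)) t :=
      Real.hasDerivAt_rpow_const (Or.inl ht.1.ne')
    have h2 : HasDerivAt (fun t : ℝ => (1 - t) ^ b) (-1 * b * (1 - t) ^ (b - 1)) t :=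
      ((hasDerivAt_id t).const_sub 1).rpow_const (Or.inl (sub_pos.2 ht.2).ne')
    have h3 : HasDerivAt h (deriv h t) t := (hh.differentiable one_ne_zero t).hasDerivAt
    refine ((h1.mul h2).mul h3).congr_deriv ?_
    simp only [Pi.mul_apply, add_sub_cancel_right]
    ring

lemma betaInt_one_succ_left (ha : 0 < a) (hb : 0 < b) :
    betaInt (a + 1) b (fun _ => 1) = a / (a + b) * betaInt a b fun _ => 1 := by
  have h0 := betaInt_deriv ha hb (h := fun _ => 1) contDiff_const
  have h1 : betaInt a (b + 1) (fun _ => 1) + betaInt (a + 1) b (fun _ => 1)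
      = betaInt a b fun _ => 1 := by
    rw [betaInt_succ_left, betaInt_succ_right, ← betaInt_add ha hb (by fun_prop) (by fun_prop)]
    congr 1; ext t; ring
  have h2 : betaInt (a + 1) (b + 1) (deriv fun _ => (1:ℝ)) = 0 := by simp [betaInt]
  have : a + b ≠ 0 := by positivity
  field_simp
  rw [← h1]
  linarith

lemma betaInt_one_succ_right (ha : 0 < a) (hb : 0 < b) :
    betaInt a (b + 1) (fun _ => 1) = b / (a + b) * betaInt a b fun _ => 1 := by
  have h0 := betaInt_deriv ha hb (h := fun _ => 1) contDiff_const
  have h2 : betaInt (a + 1) (b + 1) (deriv fun _ => (1:ℝ)) = 0 := by simp [betaInt]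
  rw [h2, betaInt_one_succ_left ha hb] at h0
  have : a + b ≠ 0 := by positivity
  refine mul_left_cancel₀ ha.ne' ?_
  linear_combination h0

lemma betaMean_succ_sub (ha : 0 < a) (hb : 0 < b) {h : ℝ → ℝ} (hh : ContDiff ℝ 1 h) :
    betaMean (a + 1) b h - betaMean a (b + 1) h =
      1 / (a + b + 1) * betaMean (a + 1) (b + 1) (deriv h) := by
  have hI := betaInt_one_pos ha hb
  have hb1 : 0 < b + 1 := by linarith
  unfold betaMean
  rw [betaInt_deriv ha hb hh, betaInt_one_succ_left ha hb1, betaInt_one_succ_right ha hb,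
    betaInt_one_succ_left ha hb]
  have : a + b ≠ 0 := by positivity
  have : a + (b + 1) ≠ 0 := by positivity
  have : a + b + 1 ≠ 0 := by positivity
  field_simp
  ring

lemma betaInt_variance (ha : 0 < a) (hb : 0 < b) :
    betaInt a b (fun t => (t - a / (a + b)) ^ 2) =
      a * b / ((a + b) ^ 2 * (a + b + 1)) * betaInt a b fun _ => 1 := by
  have ha1 : 0 < a + 1 := by linarith
  have h1 : betaInt a b (fun t => t * 1) = a / (a + b) * betaInt a b fun _ => 1 := by
    rw [← betaInt_succ_left, betaInt_one_succ_left ha hb]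
  have h2 : betaInt a b (fun t => t * (t * 1)) =
      (a + 1) / (a + 1 + b) * (a / (a + b) * betaInt a b fun _ => 1) := by
    rw [← betaInt_succ_left, ← betaInt_succ_left, betaInt_one_succ_left ha1 hb,
      betaInt_one_succ_left ha hb]
  have e : (fun t : ℝ => (t - a / (a + b)) ^ 2) = fun t =>
      t * (t * 1) + ((-2 * (a / (a + b))) * (t * 1) + (a / (a + b)) ^ 2 * 1) := by
    ext t; ring
  rw [e, betaInt_add ha hb (by fun_prop) (by fun_prop), betaInt_add ha hb (by fun_prop)
    (by fun_prop), betaInt_const_mul, betaInt_const_mul, h1, h2]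
  have : a + b ≠ 0 := by positivity
  have : a + 1 + b ≠ 0 := by positivity
  have : a + b + 1 ≠ 0 := by positivity
  field_simp
  ring

lemma abs_sub_affine_le {g : ℝ → ℝ} (hg : ContDiff ℝ 2 g) {M : ℝ}
    (hM : ∀ t ∈ Icc (0:ℝ) 1, |iteratedDeriv 2 g t| ≤ M) {c t : ℝ} (hc : c ∈ Icc (0:ℝ) 1)
    (ht : t ∈ Icc (0:ℝ) 1) : |g t - g c - deriv g c * (t - c)| ≤ M / 2 * (t - c) ^ 2 := by
  rcases eq_or_ne c t with rfl | hne
  · simp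
  obtain ⟨y, hy, e⟩ := taylor_mean_remainder_lagrange_iteratedDeriv (n := 1) hne
    (f := g) (by norm_num; exact hg.contDiffOn)
  have hd : derivWithin g (uIcc c t) c = deriv g c :=
    (hg.differentiable two_ne_zero c).derivWithin (uniqueDiffOn_uIcc hne c left_mem_uIcc)
  have hy' : y ∈ Icc (0:ℝ) 1 := by
    have := uIoo_subset_uIcc_self hy
    exact ⟨(le_min hc.1 ht.1).trans this.1, this.2.trans (max_le hc.2 ht.2)⟩
  rw [taylorWithinEval_succ, taylor_within_zero_eval, iteratedDerivWithin_one, hd] at e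
  norm_num at e
  have : g t - g c - deriv g c * (t - c) = iteratedDeriv 2 g y * (t - c) ^ 2 / 2 := by
    rw [← e]; ring
  rw [this, abs_div, abs_mul, abs_of_nonneg (sq_nonneg (t - c)), abs_two]
  nlinarith [mul_le_mul_of_nonneg_right (hM y hy') (sq_nonneg (t - c))]

lemma div_add_mem_Icc (ha : 0 < a) (hb : 0 < b) : a / (a + b) ∈ Icc (0:ℝ) 1 :=
  ⟨by positivity, by rw [div_le_one (by positivity)]; linarith⟩

lemma abs_betaMean_sub_le (ha : 0 < a) (hb : 0 < b) {g : ℝ → ℝ} (hg : ContDiff ℝ 2 g) {M : ℝ}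
    (hM : ∀ t ∈ Icc (0:ℝ) 1, |iteratedDeriv 2 g t| ≤ M) :
    |betaMean a b g - g (a / (a + b))| ≤ M / (8 * (a + b + 1)) := by
  have hI := betaInt_one_pos ha hb
  have hM0 : 0 ≤ M := (abs_nonneg _).trans (hM 0 (by simp))
  have hc := div_add_mem_Icc ha hb
  have hv := betaInt_variance ha hb
  have h1 : betaInt a b (fun t => t * 1) = a / (a + b) * betaInt a b fun _ => 1 := by
    rw [← betaInt_succ_left, betaInt_one_succ_left ha hb]
  set c := a / (a + b)
  have hgc := hg.continuous
  have affine (s : ℝ) : betaInt a b (fun t => (g c - deriv g c * c) * 1 + (deriv g c * (t * 1) +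
      s * (t - c) ^ 2)) = g c * betaInt a b (fun _ => 1) + s * (a * b / ((a + b) ^ 2 * (a + b + 1)) *
      betaInt a b fun _ => 1) := by
    rw [betaInt_add ha hb (by fun_prop) (by fun_prop), betaInt_add ha hb (by fun_prop)
      (by fun_prop), betaInt_const_mul, betaInt_const_mul, betaInt_const_mul, h1, hv]
    ring
  have up : betaInt a b g ≤ _ := (betaInt_mono ha hb hgc (by fun_prop) fun t ht => by
    linarith [(abs_le.1 (abs_sub_affine_le hg hM hc ht)).2]).trans_eq (affine (M / 2))
  have low := (affine (-(M / 2))).symm.trans_le (betaInt_mono ha hb (by fun_prop) hgc fun t ht => by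
    linarith [(abs_le.1 (abs_sub_affine_le hg hM hc ht)).1])
  have hvar : M / 2 * (a * b / ((a + b) ^ 2 * (a + b + 1))) ≤ M / (8 * (a + b + 1)) := by
    rw [← mul_div_assoc, div_le_div_iff₀ (by positivity) (by positivity)]
    have : 0 ≤ M * (a + b + 1) * (a - b) ^ 2 := by positivity
    nlinarith
  refine le_trans ?_ hvar
  rw [abs_le]
  unfold betaMean
  constructor
  · rw [le_sub_iff_add_le, le_div_iff₀ hI]; linarith
  · rw [sub_le_iff_le_add, div_le_iff₀ hI]; linarith

end BetaInt

section Durrmeyer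

open Set

lemma bern_eq_eval (n k : ℕ) : bern n k = fun x => (bernsteinPolynomial ℝ n k).eval x := by
  ext x; simp [bern, bernsteinPolynomial]

lemma bern_nonneg (n k : ℕ) {x : ℝ} (hx : x ∈ Icc (0:ℝ) 1) : 0 ≤ bern n k x := by
  have := sub_nonneg.2 hx.2
  have := hx.1
  unfold bern
  positivity

lemma sum_bern (n : ℕ) (x : ℝ) : ∑ k ∈ Finset.range (n + 1), bern n k x = 1 := by
  simp_rw [bern_eq_eval, ← Polynomial.eval_finsetSum, bernsteinPolynomial.sum, Polynomial.eval_one]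

lemma hasDerivAt_bern_succ (n k : ℕ) (x : ℝ) :
    HasDerivAt (bern (n + 1) (k + 1)) ((n + 1) * (bern n k x - bern n (k + 1) x)) x := by
  have := (bernsteinPolynomial ℝ (n + 1) (k + 1)).hasDerivAt x
  rw [bernsteinPolynomial.derivative_succ_aux] at this
  simpa [bern_eq_eval] using this

lemma hasDerivAt_bern_zero (n : ℕ) (x : ℝ) :
    HasDerivAt (bern (n + 1) 0) (-((n + 1) * bern n 0 x)) x := by
  have := (bernsteinPolynomial ℝ (n + 1) 0).hasDerivAt x
  rw [bernsteinPolynomial.derivative_zero] at this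
  refine (bern_eq_eval (n + 1) 0 ▸ this).congr_deriv ?_
  simp [bern_eq_eval]
  ring

lemma hasDerivAt_sum_bern (n : ℕ) (c : ℕ → ℝ) (x : ℝ) :
    HasDerivAt (fun y => ∑ k ∈ Finset.range (n + 2), bern (n + 1) k y * c k)
      ((n + 1) * ∑ k ∈ Finset.range (n + 1), bern n k x * (c (k + 1) - c k)) x := by
  simp_rw [Finset.sum_range_succ' _ (n + 1)]
  refine ((HasDerivAt.fun_sum fun k _ => (hasDerivAt_bern_succ n k x).mul_const (c (k + 1))).add
    ((hasDerivAt_bern_zero n x).mul_const (c 0))).congr_deriv ?_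
  have h : ∑ k ∈ Finset.range (n + 1), bern n (k + 1) x * c (k + 1) + bern n 0 x * c 0 =
      ∑ k ∈ Finset.range (n + 1), bern n k x * c k := by
    rw [← Finset.sum_range_succ' (fun k => bern n k x * c k), Finset.sum_range_succ]
    simp [bern]
  simp_rw [mul_sub, Finset.sum_sub_distrib, ← h, sub_mul, Finset.sum_sub_distrib, mul_assoc,
    ← Finset.mul_sum]
  ring

lemma durrmeyerJ_eq_sum_betaMean (α β : ℝ) (n : ℕ) (f : ℝ → ℝ) (x : ℝ) :
    durrmeyerJ α β n f x =
      ∑ k ∈ Finset.range (n + 1), bern n k x * betaMean (k + α + 1) (n - k + β + 1) f := by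
  refine Finset.sum_congr rfl fun k hk => ?_
  have hkn : k ≤ n := Nat.lt_succ_iff.1 (Finset.mem_range.1 hk)
  have key (h : ℝ → ℝ) : ∫ t in (0:ℝ)..1, bern n k t * t ^ α * (1 - t) ^ β * h t =
      n.choose k * betaInt (k + α + 1) (n - k + β + 1) h := by
    rw [betaInt, ← intervalIntegral.integral_const_mul]
    refine intervalIntegral.integral_congr_Ioo_of_le zero_le_one fun t ht => ?_
    simp only [bern, add_sub_cancel_right]
    rw [Real.rpow_add ht.1, Real.rpow_add (sub_pos.2 ht.2), Real.rpow_natCast, ← Nat.cast_sub hkn,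
      Real.rpow_natCast]
    ring
  have key1 := key fun _ => 1
  simp only [mul_one] at key1
  have : (n.choose k : ℝ) ≠ 0 := by exact_mod_cast (Nat.choose_pos hkn).ne'
  rw [key, key1, betaMean, mul_div_mul_left _ _ this]

lemma deriv_durrmeyerJ {α β : ℝ} (hα : -1 < α) (hβ : -1 < β) (n : ℕ) {f : ℝ → ℝ}
    (hf : ContDiff ℝ 1 f) :
    deriv (durrmeyerJ α β (n + 1) f) = fun x =>
      (n + 1) / (n + α + β + 3) * durrmeyerJ (α + 1) (β + 1) n (deriv f) x := by
  ext x
  rw [funext (durrmeyerJ_eq_sum_betaMean α β (n + 1) f)]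
  refine (hasDerivAt_sum_bern n _ x).deriv.trans ?_
  rw [durrmeyerJ_eq_sum_betaMean, Finset.mul_sum, Finset.mul_sum]
  refine Finset.sum_congr rfl fun k hk => ?_
  have hkn : (k : ℝ) ≤ n := by exact_mod_cast Nat.lt_succ_iff.1 (Finset.mem_range.1 hk)
  have hk0 : (0 : ℝ) ≤ k := k.cast_nonneg
  have := betaMean_succ_sub (a := k + α + 1) (b := n - k + β + 1) (by linarith) (by linarith) hf
  have e1 : ((k + 1 : ℕ) : ℝ) + α + 1 = k + α + 1 + 1 := by push_cast; ring
  have e2 : ((n + 1 : ℕ) : ℝ) - ((k + 1 : ℕ) : ℝ) + β + 1 = n - k + β + 1 := by push_cast; ring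
  have e3 : ((n + 1 : ℕ) : ℝ) - k + β + 1 = n - k + β + 1 + 1 := by push_cast; ring
  have e4 : (k : ℝ) + α + 1 + (n - k + β + 1) + 1 = n + α + β + 3 := by ring
  rw [e1, e2, e3, this, e4, ← add_assoc (k : ℝ), ← add_assoc ((n : ℝ) - k)]
  ring

lemma iteratedDeriv_durrmeyerJ (m r : ℕ) {α β : ℝ} (hα : -1 < α) (hβ : -1 < β) {f : ℝ → ℝ}
    (hf : ContDiff ℝ r f) (x : ℝ) :
    Real.Gamma (((m + r : ℕ) : ℝ) + α + β + r + 2) * Real.Gamma (m + 1) /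
        (Real.Gamma (((m + r : ℕ) : ℝ) + α + β + 2) * Real.Gamma (((m + r : ℕ) : ℝ) + 1)) *
        iteratedDeriv r (durrmeyerJ α β (m + r) f) x =
      durrmeyerJ (α + r) (β + r) m (iteratedDeriv r f) x := by
  induction r generalizing α β f with
  | zero =>
    have hm : (0 : ℝ) ≤ m := m.cast_nonneg
    have h1 := (Real.Gamma_pos_of_pos (by linarith : 0 < (m : ℝ) + α + β + 2)).ne'
    have h2 := (Real.Gamma_pos_of_pos (by linarith : 0 < (m : ℝ) + 1)).ne'
    simp [h1, h2]
  | succ r ih =>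
    have hd : ContDiff ℝ r (deriv f) := by
      have : ContDiff ℝ ((r : WithTop ℕ∞) + 1) f := by exact_mod_cast hf
      exact (contDiff_succ_iff_deriv.1 this).2.2
    have h1 : ContDiff ℝ 1 f := hf.of_le (by norm_cast; omega)
    have ih' := ih (α := α + 1) (β := β + 1) (by linarith) (by linarith) hd
    rw [iteratedDeriv_succ', iteratedDeriv_succ', ← add_assoc, deriv_durrmeyerJ hα hβ _ h1,
      iteratedDeriv_const_mul_field]
    have hs : (0 : ℝ) ≤ ((m + r : ℕ) : ℝ) := Nat.cast_nonneg _
    have e1 : α + 1 + r = α + (r + 1 : ℕ) := by push_cast; ring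
    have e2 : β + 1 + r = β + (r + 1 : ℕ) := by push_cast; ring
    rw [e1, e2] at ih'
    rw [← ih', Nat.cast_add_one (m + r), Nat.cast_add_one r]
    set s : ℝ := ((m + r : ℕ) : ℝ)
    have e3 : s + 1 + α + β + (r + 1) + 2 = s + (α + 1) + (β + 1) + r + 2 := by ring
    have e4 : s + 1 + α + β + 2 = s + α + β + 3 := by ring
    have e5 : s + (α + 1) + (β + 1) + 2 = s + α + β + 3 + 1 := by ring
    have hp : 0 < s + α + β + 3 := by linarith
    have hp' : 0 < s + 1 := by linarith
    rw [e3, e4, e5, Real.Gamma_add_one hp.ne', Real.Gamma_add_one hp'.ne']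
    have := (Real.Gamma_pos_of_pos hp).ne'
    have := (Real.Gamma_pos_of_pos hp').ne'
    have := hp.ne'
    have := hp'.ne'
    field_simp

lemma abs_le_supNorm {g : ℝ → ℝ} (hg : Continuous g) {x : ℝ} (hx : x ∈ Icc (0:ℝ) 1) :
    |g x| ≤ supNorm g := by
  refine le_ciSup (f := fun x : Icc (0:ℝ) 1 => |g x|) ?_ ⟨x, hx⟩
  exact (isCompact_range (by fun_prop : Continuous fun x : Icc (0:ℝ) 1 => |g x|)).bddAbove

lemma abs_sub_le_modCont {g : ℝ → ℝ} (hg : Continuous g) {x y δ : ℝ} (hx : x ∈ Icc (0:ℝ) 1)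
    (hy : y ∈ Icc (0:ℝ) 1) (hxy : |x - y| ≤ δ) : |g x - g y| ≤ modCont g δ := by
  refine le_csSup ⟨supNorm g + supNorm g, ?_⟩ ⟨x, hx, y, hy, hxy, rfl⟩
  rintro _ ⟨u, hu, v, hv, -, rfl⟩
  exact (abs_sub _ _).trans (add_le_add (abs_le_supNorm hg hu) (abs_le_supNorm hg hv))

lemma abs_beta_center_sub_le {α β : ℝ} (hα : -1 < α) (hβ : -1 < β) {m k r : ℝ} (hk : 0 ≤ k)
    (hkm : k ≤ m) (hr : 0 ≤ r) :
    |(k + (α + r) + 1) / ((k + (α + r) + 1) + (m - k + (β + r) + 1)) -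
        (k + α + 1) / ((k + α + 1) + (m - k + β + 1))| ≤
      r * (m + |β - α|) / ((m + r + 2 + α + β) ^ 2 - r ^ 2) := by
  have hs : 0 < m + α + β + 2 := by linarith
  have hs' : 0 < m + α + β + 2 + 2 * r := by linarith
  have e1 : (k + (α + r) + 1) + (m - k + (β + r) + 1) = m + α + β + 2 + 2 * r := by ring
  have e2 : (k + α + 1) + (m - k + β + 1) = m + α + β + 2 := by ring
  have e3 : (m + r + 2 + α + β) ^ 2 - r ^ 2 = (m + α + β + 2 + 2 * r) * (m + α + β + 2) := by ring
  have e4 : (k + (α + r) + 1) * (m + α + β + 2) - (m + α + β + 2 + 2 * r) * (k + α + 1) =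
      r * ((m - 2 * k) + (β - α)) := by ring
  rw [e1, e2, e3, div_sub_div _ _ hs'.ne' hs.ne', e4, abs_div, abs_of_pos (mul_pos hs' hs), abs_mul,
    abs_of_nonneg hr]
  have h1 : |m - 2 * k| ≤ m := abs_le.2 ⟨by linarith, by linarith⟩
  have h2 := abs_add_le (m - 2 * k) (β - α)
  gcongr
  linarith

lemma abs_durrmeyerJ_sub_le {α β : ℝ} (hα : -1 < α) (hβ : -1 < β) (m : ℕ) {r : ℝ} (hr : 0 ≤ r)
    {g : ℝ → ℝ} (hg : ContDiff ℝ 2 g) {x : ℝ} (hx : x ∈ Icc (0:ℝ) 1) :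
    |durrmeyerJ (α + r) (β + r) m g x - durrmeyerJ α β m g x| ≤
      (1 / 4) * supNorm (iteratedDeriv 2 g) *
          ((m + r + α + β + 3) / ((m + r + α + β + 3) ^ 2 - r ^ 2)) +
        modCont g (r * (m + |β - α|) / ((m + r + 2 + α + β) ^ 2 - r ^ 2)) := by
  have hM : ∀ t ∈ Icc (0:ℝ) 1, |iteratedDeriv 2 g t| ≤ supNorm (iteratedDeriv 2 g) :=
    fun t ht => abs_le_supNorm (hg.continuous_iteratedDeriv' 2) ht
  rw [durrmeyerJ_eq_sum_betaMean, durrmeyerJ_eq_sum_betaMean, ← Finset.sum_sub_distrib]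
  set B := (1 / 4) * supNorm (iteratedDeriv 2 g) *
          ((m + r + α + β + 3) / ((m + r + α + β + 3) ^ 2 - r ^ 2)) +
        modCont g (r * (m + |β - α|) / ((m + r + 2 + α + β) ^ 2 - r ^ 2)) with hB
  refine (Finset.abs_sum_le_sum_abs _ _).trans ?_
  rw [show B = (∑ k ∈ Finset.range (m + 1), bern m k x) * B by rw [sum_bern, one_mul],
    Finset.sum_mul]
  refine Finset.sum_le_sum fun k hk => ?_
  rw [← mul_sub, abs_mul, abs_of_nonneg (bern_nonneg m k hx)]
  refine mul_le_mul_of_nonneg_left ?_ (bern_nonneg m k hx)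
  have hkm : (k : ℝ) ≤ m := by exact_mod_cast Nat.lt_succ_iff.1 (Finset.mem_range.1 hk)
  have hk0 : (0 : ℝ) ≤ k := k.cast_nonneg
  have ha : 0 < (k : ℝ) + α + 1 := by linarith
  have hb : 0 < (m : ℝ) - k + β + 1 := by linarith
  have ha' : 0 < (k : ℝ) + (α + r) + 1 := by linarith
  have hb' : 0 < (m : ℝ) - k + (β + r) + 1 := by linarith
  have h1 := abs_betaMean_sub_le ha hb hg hM
  have h2 := abs_betaMean_sub_le ha' hb' hg hM
  have h3 := abs_sub_le_modCont hg.continuous (div_add_mem_Icc ha' hb') (div_add_mem_Icc ha hb)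
    (abs_beta_center_sub_le hα hβ hk0 hkm hr)
  have hsum : supNorm (iteratedDeriv 2 g) / (8 * (k + (α + r) + 1 + (m - k + (β + r) + 1) + 1)) +
      supNorm (iteratedDeriv 2 g) / (8 * (k + α + 1 + (m - k + β + 1) + 1)) =
      (1 / 4) * supNorm (iteratedDeriv 2 g) *
          ((m + r + α + β + 3) / ((m + r + α + β + 3) ^ 2 - r ^ 2)) := by
    have e1 : (k : ℝ) + (α + r) + 1 + (m - k + (β + r) + 1) + 1 = m + α + β + 3 + 2 * r := by ring
    have e2 : (k : ℝ) + α + 1 + (m - k + β + 1) + 1 = m + α + β + 3 := by ring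
    have e3 : ((m : ℝ) + r + α + β + 3) ^ 2 - r ^ 2 =
      (m + α + β + 3 + 2 * r) * (m + α + β + 3) := by ring
    have hp : (m : ℝ) + α + β + 3 + 2 * r ≠ 0 := by linarith
    have hp' : (m : ℝ) + α + β + 3 ≠ 0 := by linarith
    rw [e1, e2, e3]
    field_simp
    ring
  rw [hB, ← hsum]
  rw [abs_le] at *
  constructor <;> linarith [h1.1, h1.2, h2.1, h2.2, h3.1, h3.2]

end Durrmeyer

theorem durrmeyerJ_derivative_difference_normalized
    (α β : ℝ) (hα : -1 < α) (hβ : -1 < β)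
    (n r : ℕ) (hr1 : 1 ≤ r) (hr2 : r ≤ n)
    (f : ℝ → ℝ) (hf : ContDiff ℝ (r + 2 : ℕ) f) :
    ∀ x ∈ Set.Icc (0:ℝ) 1,
      |Real.Gamma ((n : ℝ) + α + β + (r : ℝ) + 2) * Real.Gamma ((n : ℝ) - (r : ℝ) + 1) /
            (Real.Gamma ((n : ℝ) + α + β + 2) * Real.Gamma ((n : ℝ) + 1)) *
            iteratedDeriv r (durrmeyerJ α β n f) x
          - durrmeyerJ α β (n - r) (iteratedDeriv r f) x| ≤
        (1 / 4) * supNorm (iteratedDeriv (r + 2) f) *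
            (((n : ℝ) + α + β + 3) / (((n : ℝ) + α + β + 3) ^ 2 - (r : ℝ) ^ 2))
          + modCont (iteratedDeriv r f)
              ((r : ℝ) * ((n : ℝ) - (r : ℝ) + |β - α|) /
                (((n : ℝ) + 2 + α + β) ^ 2 - (r : ℝ) ^ 2)) := by
  intro x hx
  obtain ⟨m, rfl⟩ := Nat.exists_eq_add_of_le' hr2
  have hg : ContDiff ℝ 2 (iteratedDeriv r f) := by
    rw [iteratedDeriv_eq_iterate]
    exact ContDiff.iterate_deriv' 2 r (by rwa [add_comm] at hf)
  have hf' : ContDiff ℝ r f := hf.of_le (by norm_cast; omega)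
  have e : ((m + r : ℕ) : ℝ) - r = m := by push_cast; ring
  have e' : iteratedDeriv (r + 2) f = iteratedDeriv 2 (iteratedDeriv r f) := by
    simp only [iteratedDeriv_eq_iterate, add_comm r 2, Function.iterate_add_apply]
  rw [e, iteratedDeriv_durrmeyerJ m r hα hβ hf', Nat.add_sub_cancel, e', Nat.cast_add]
  exact abs_durrmeyerJ_sub_le hα hβ m r.cast_nonneg hg hx
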